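/- Let w be a vertex of a nontrivial connected graph G. For nonnegative integers p and q, let G(p,q) denote the graph obtained from G by attaching to w two pendant paths P = w v₁ v₂ ⋯ v_p and Q = w u₁ u₂ ⋯ u_q of lengths p and q respectively. If p ≥ q ≥ 1, then ξ^{ce}(G(p,q)) ≥ ξ^{ce}(G(p+1,q−1)). -/

import Mathlib

open Finset SimpleGraph

variable {V : Type*}

open Classical in
/-- The degree of a vertex `u` in a graph `G` (number of neighbors). -/
noncomputable def deg [Fintype V] (G : SimpleGraph V) (u : V) : ℕ :=
  (Finset.univ.filter (fun v => G.Adj u v)).card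

/-- The eccentricity of a vertex `u`: the maximum distance from `u` to any vertex. -/
noncomputable def ecc [Fintype V] (G : SimpleGraph V) (u : V) : ℕ :=
  Finset.univ.sup (fun v => G.dist u v)

/-- The connective eccentricity index `ξ^{ce}(G) = Σ_{u ∈ V} d(u)/ε(u)`. -/
noncomputable def cei [Fintype V] (G : SimpleGraph V) : ℝ :=
  ∑ u : V, (deg G u : ℝ) / (ecc G u)

/-- `G(p,q)`: the graph obtained from `G` by attaching to the vertex `w` two pendant
paths `w v₁ v₂ ⋯ v_p` and `w u₁ u₂ ⋯ u_q` of lengths `p` and `q` (`vᵢ = Sum.inr (Sum.inl i)`,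
`uᵢ = Sum.inr (Sum.inr i)`). -/
def attachTwoPaths (G : SimpleGraph V) (w : V) (p q : ℕ) :
    SimpleGraph (V ⊕ (Fin p ⊕ Fin q)) :=
  SimpleGraph.fromRel (fun x y =>
    (∃ a b, x = Sum.inl a ∧ y = Sum.inl b ∧ G.Adj a b) ∨
    (∃ i : Fin p, (i : ℕ) = 0 ∧ x = Sum.inl w ∧ y = Sum.inr (Sum.inl i)) ∨
    (∃ i j : Fin p, (j : ℕ) = (i : ℕ) + 1 ∧
      x = Sum.inr (Sum.inl i) ∧ y = Sum.inr (Sum.inl j)) ∨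
    (∃ i : Fin q, (i : ℕ) = 0 ∧ x = Sum.inl w ∧ y = Sum.inr (Sum.inr i)) ∨
    (∃ i j : Fin q, (j : ℕ) = (i : ℕ) + 1 ∧
      x = Sum.inr (Sum.inr i) ∧ y = Sum.inr (Sum.inr j)))

/-- A function which vanishes exactly at `x`, grows by at most one along edges, and decreases by
one along some edge wherever it is positive, is the distance from `x`. -/
lemma SimpleGraph.dist_eq_of_potential {W : Type*} {H : SimpleGraph W} {x : W} {f : W → ℕ}
    (hx : f x = 0) (hzero : ∀ y, f y = 0 → y = x)
    (hlip : ∀ y z, H.Adj y z → f z ≤ f y + 1)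
    (hdesc : ∀ z n, f z = n + 1 → ∃ y, H.Adj y z ∧ f y = n) (z : W) :
    H.dist x z = f z := by
  have hwalk : ∀ n z, f z = n → ∃ W : H.Walk x z, W.length = n := by
    intro n
    induction n with
    | zero =>
      intro z hz
      obtain rfl := hzero z hz
      exact ⟨Walk.nil, rfl⟩
    | succ n ih =>
      intro z hz
      obtain ⟨y, hyz, hy⟩ := hdesc z n hz
      obtain ⟨W, hW⟩ := ih y hy
      exact ⟨W.concat hyz, by simp [hW]⟩
  have hlow : ∀ {y z : W} (P : H.Walk y z), f z ≤ f y + P.length := by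
    intro y z P
    induction P with
    | nil => simp
    | cons h P ih =>
      have := hlip _ _ h
      simp only [Walk.length_cons]
      omega
  obtain ⟨W, hW⟩ := hwalk (f z) z rfl
  refine le_antisymm (hW ▸ dist_le W) ?_
  obtain ⟨P, hP⟩ := W.reachable.exists_walk_length_eq_dist
  have := hlow P
  omega

lemma dist_le_ecc [Fintype V] (G : SimpleGraph V) (u v : V) : G.dist u v ≤ ecc G u :=
  Finset.le_sup (f := fun v => G.dist u v) (Finset.mem_univ v)

lemma exists_dist_eq_ecc [Fintype V] (G : SimpleGraph V) (u : V) : ∃ v, G.dist u v = ecc G u := by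
  obtain ⟨v, -, hv⟩ := Finset.exists_mem_eq_sup Finset.univ ⟨u, Finset.mem_univ u⟩
    (fun v => G.dist u v)
  exact ⟨v, hv.symm⟩

lemma ecc_eq_of_dist [Fintype V] {G : SimpleGraph V} {u : V} {n : ℕ}
    (hle : ∀ v, G.dist u v ≤ n) (hex : ∃ v, n ≤ G.dist u v) : ecc G u = n := by
  obtain ⟨v, hv⟩ := hex
  exact le_antisymm (Finset.sup_le fun v _ => hle v) (hv.trans (dist_le_ecc G u v))

lemma exists_adj_dist_eq {G : SimpleGraph V} (hG : G.Connected) {a b : V} {n : ℕ}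
    (h : G.dist a b = n + 1) : ∃ c, G.Adj c b ∧ G.dist a c = n := by
  obtain ⟨P, hP⟩ := hG.exists_walk_length_eq_dist b a
  rw [SimpleGraph.dist_comm, h] at hP
  cases P with
  | nil => simp at hP
  | @cons _ c _ hbc P =>
    refine ⟨c, hbc.symm, ?_⟩
    have h₁ := dist_le P
    have h₂ := hG.dist_triangle (u := a) (v := c) (w := b)
    rw [dist_eq_one_iff_adj.mpr hbc.symm] at h₂
    rw [SimpleGraph.dist_comm] at h₁
    simp only [Walk.length_cons] at hP
    omega

section attachTwoPaths

variable {G : SimpleGraph V} {w : V} {p q : ℕ}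

@[simp]
lemma attachTwoPaths_adj_inl_inl {a b : V} :
    (attachTwoPaths G w p q).Adj (.inl a) (.inl b) ↔ G.Adj a b := by
  simp only [attachTwoPaths, fromRel_adj]
  constructor
  · rintro ⟨-, h⟩
    simpa [G.adj_comm b a] using h
  · intro h
    simpa [h] using h.ne

@[simp]
lemma attachTwoPaths_adj_inl_left {a : V} {i : Fin p} :
    (attachTwoPaths G w p q).Adj (.inl a) (.inr (.inl i)) ↔ a = w ∧ (i : ℕ) = 0 := by
  simp [attachTwoPaths, and_comm]

@[simp]
lemma attachTwoPaths_adj_inl_right {a : V} {i : Fin q} :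
    (attachTwoPaths G w p q).Adj (.inl a) (.inr (.inr i)) ↔ a = w ∧ (i : ℕ) = 0 := by
  simp [attachTwoPaths, and_comm]

@[simp]
lemma attachTwoPaths_adj_left_inl {a : V} {i : Fin p} :
    (attachTwoPaths G w p q).Adj (.inr (.inl i)) (.inl a) ↔ a = w ∧ (i : ℕ) = 0 := by
  rw [adj_comm, attachTwoPaths_adj_inl_left]

@[simp]
lemma attachTwoPaths_adj_right_inl {a : V} {i : Fin q} :
    (attachTwoPaths G w p q).Adj (.inr (.inr i)) (.inl a) ↔ a = w ∧ (i : ℕ) = 0 := by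
  rw [adj_comm, attachTwoPaths_adj_inl_right]

@[simp]
lemma attachTwoPaths_adj_left_left {i j : Fin p} :
    (attachTwoPaths G w p q).Adj (.inr (.inl i)) (.inr (.inl j)) ↔
      (j : ℕ) = i + 1 ∨ (i : ℕ) = j + 1 := by
  simp only [attachTwoPaths, fromRel_adj]
  simp [Fin.ext_iff]
  grind

@[simp]
lemma attachTwoPaths_adj_right_right {i j : Fin q} :
    (attachTwoPaths G w p q).Adj (.inr (.inr i)) (.inr (.inr j)) ↔
      (j : ℕ) = i + 1 ∨ (i : ℕ) = j + 1 := by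
  simp only [attachTwoPaths, fromRel_adj]
  simp [Fin.ext_iff]
  grind

@[simp]
lemma attachTwoPaths_not_adj_left_right {i : Fin p} {j : Fin q} :
    ¬ (attachTwoPaths G w p q).Adj (.inr (.inl i)) (.inr (.inr j)) := by
  simp [attachTwoPaths]

@[simp]
lemma attachTwoPaths_not_adj_right_left {i : Fin p} {j : Fin q} :
    ¬ (attachTwoPaths G w p q).Adj (.inr (.inr j)) (.inr (.inl i)) := by
  simp [attachTwoPaths]

/-- Interchanging the two pendant paths. -/
def attachTwoPathsSwap (G : SimpleGraph V) (w : V) (p q : ℕ) :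
    attachTwoPaths G w p q ≃g attachTwoPaths G w q p where
  toEquiv := Equiv.sumCongr (Equiv.refl V) (Equiv.sumComm (Fin p) (Fin q))
  map_rel_iff' {x y} := by
    rcases x with a | i | i <;> rcases y with b | j | j <;> simp

/-- The distance from a vertex of `G` inside `attachTwoPaths G w p q`. -/
lemma attachTwoPaths_dist_inl (hG : G.Connected) (a : V) (z : V ⊕ (Fin p ⊕ Fin q)) :
    (attachTwoPaths G w p q).dist (.inl a) z =
      Sum.elim (fun b => G.dist a b)
        (Sum.elim (fun i : Fin p => G.dist a w + (i + 1))
          (fun j : Fin q => G.dist a w + (j + 1))) z := by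
  refine dist_eq_of_potential (by simp) ?_ ?_ ?_ z
  · rintro (b | i | i) h
    · simpa [hG.dist_eq_zero_iff, eq_comm] using h
    · simp at h
    · simp at h
  · have key : ∀ b c, G.Adj b c → G.dist a c ≤ G.dist a b + 1 := fun b c h => by
      simpa [dist_eq_one_iff_adj.mpr h] using hG.dist_triangle (u := a) (v := b) (w := c)
    rintro (b | i | i) (c | j | j) h <;> simp at h ⊢ <;> grind
  · rintro (b | i | i) n h
    · obtain ⟨c, hc, hd⟩ := exists_adj_dist_eq hG h
      exact ⟨.inl c, by simpa, by simpa⟩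
    · obtain ⟨_ | k, hk⟩ := i
      · exact ⟨.inl w, by simp, by simp at h ⊢; omega⟩
      · exact ⟨.inr (.inl ⟨k, by omega⟩), by simp, by simp at h ⊢; omega⟩
    · obtain ⟨_ | k, hk⟩ := i
      · exact ⟨.inl w, by simp, by simp at h ⊢; omega⟩
      · exact ⟨.inr (.inr ⟨k, by omega⟩), by simp, by simp at h ⊢; omega⟩

/-- The distance from a vertex of the first pendant path inside `attachTwoPaths G w p q`. -/
lemma attachTwoPaths_dist_left (hG : G.Connected) (i : Fin p) (z : V ⊕ (Fin p ⊕ Fin q)) :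
    (attachTwoPaths G w p q).dist (.inr (.inl i)) z =
      Sum.elim (fun b => G.dist w b + (i + 1))
        (Sum.elim (fun j : Fin p => (i - j) + (j - i)) (fun j : Fin q => (i + 1) + (j + 1))) z := by
  refine dist_eq_of_potential (by simp) ?_ ?_ ?_ z
  · rintro (b | j | j) h <;> simp [Fin.ext_iff] at h ⊢
    omega
  · have key : ∀ b c, G.Adj b c → G.dist w c ≤ G.dist w b + 1 := fun b c h => by
      simpa [dist_eq_one_iff_adj.mpr h] using hG.dist_triangle (u := w) (v := b) (w := c)
    have hw : G.dist w w = 0 := dist_self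
    rintro (b | j | j) (c | k | k) h <;> simp at h ⊢ <;> grind
  · rintro (b | j | j) n h
    · rcases Nat.eq_zero_or_pos (G.dist w b) with hb | hb
      · obtain rfl := hG.dist_eq_zero_iff.mp hb
        obtain ⟨_ | k, hk⟩ := i
        · exact ⟨.inr (.inl ⟨0, hk⟩), by simp, by simp at h ⊢; omega⟩
        · exact ⟨.inr (.inl ⟨0, by omega⟩), by simp, by simp at h ⊢; omega⟩
      · obtain ⟨m, hm⟩ := Nat.exists_eq_add_of_le' hb
        obtain ⟨c, hc, hd⟩ := exists_adj_dist_eq hG hm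
        exact ⟨.inl c, by simpa, by simp at h ⊢; omega⟩
    · simp only [Sum.elim_inr, Sum.elim_inl] at h
      rcases lt_or_ge (i : ℕ) j with hij | hij
      · exact ⟨.inr (.inl ⟨j - 1, by omega⟩), by simp; omega, by simp; omega⟩
      · exact ⟨.inr (.inl ⟨j + 1, by omega⟩), by simp, by simp; omega⟩
    · obtain ⟨_ | k, hk⟩ := j
      · exact ⟨.inl w, by simp, by simp at h ⊢; omega⟩
      · exact ⟨.inr (.inr ⟨k, by omega⟩), by simp, by simp at h ⊢; omega⟩

variable [Fintype V]

lemma ecc_attachTwoPaths_inl (hG : G.Connected) (a : V) :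
    ecc (attachTwoPaths G w p q) (.inl a) = max (ecc G a) (G.dist a w + max p q) := by
  have hw := dist_le_ecc G a w
  obtain ⟨v, hv⟩ := exists_dist_eq_ecc G a
  refine ecc_eq_of_dist ?_ ?_
  · rintro (b | i | i)
    · have := dist_le_ecc G a b
      simp [attachTwoPaths_dist_inl hG, this]
    all_goals simp only [attachTwoPaths_dist_inl hG, Sum.elim_inl, Sum.elim_inr]; omega
  · rcases le_total (G.dist a w + max p q) (ecc G a) with h | h
    · exact ⟨.inl v, by simp [attachTwoPaths_dist_inl hG]; omega⟩
    · by_cases hpq : max p q = 0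
      · exact ⟨.inl v, by simp [attachTwoPaths_dist_inl hG]; omega⟩
      · rcases le_total p q with h' | h'
        · exact ⟨.inr (.inr ⟨q - 1, by omega⟩), by simp [attachTwoPaths_dist_inl hG]; omega⟩
        · exact ⟨.inr (.inl ⟨p - 1, by omega⟩), by simp [attachTwoPaths_dist_inl hG]; omega⟩

/-- The eccentricity of the vertex at distance `k` from the root on a pendant path of length `p`,
when the other pendant path has length `q` and the root has eccentricity `e` in the core. -/
def pathEcc (e p q k : ℕ) : ℕ := max (p - k) (k + max e q)

lemma ecc_attachTwoPaths_left (hG : G.Connected) (i : Fin p) :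
    ecc (attachTwoPaths G w p q) (.inr (.inl i)) = pathEcc (ecc G w) p q (i + 1) := by
  obtain ⟨v, hv⟩ := exists_dist_eq_ecc G w
  unfold pathEcc
  refine ecc_eq_of_dist ?_ ?_
  · rintro (b | j | j)
    · have := dist_le_ecc G w b
      simp [attachTwoPaths_dist_left hG]; omega
    all_goals simp only [attachTwoPaths_dist_left hG, Sum.elim_inl, Sum.elim_inr]; omega
  · rcases le_total (p - (i + 1)) (i + 1 + max (ecc G w) q) with h | h
    · rcases le_total q (ecc G w) with h' | h'
      · exact ⟨.inl v, by simp [attachTwoPaths_dist_left hG]; omega⟩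
      · by_cases hq : q = 0
        · exact ⟨.inl v, by simp [attachTwoPaths_dist_left hG]; omega⟩
        · exact ⟨.inr (.inr ⟨q - 1, by omega⟩), by simp [attachTwoPaths_dist_left hG]; omega⟩
    · exact ⟨.inr (.inl ⟨p - 1, by omega⟩), by simp [attachTwoPaths_dist_left hG]; omega⟩

lemma SimpleGraph.dist_map_iso {W W' : Type*} {H : SimpleGraph W} {H' : SimpleGraph W'}
    (φ : H ≃g H') (u v : W) : H'.dist (φ u) (φ v) = H.dist u v := by
  by_cases h : H.Reachable u v
  · obtain ⟨P, hP⟩ := h.exists_walk_length_eq_dist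
    obtain ⟨Q, hQ⟩ := (φ.reachable_iff.mpr h).exists_walk_length_eq_dist
    have h₁ := dist_le (P.map φ.toHom)
    have h₂ := dist_le (Q.map φ.symm.toHom)
    simp at h₁ h₂
    omega
  · rw [dist_eq_zero_of_not_reachable h,
      dist_eq_zero_of_not_reachable (mt φ.reachable_iff.mp h)]

lemma ecc_map_iso {W W' : Type*} [Fintype W] [Fintype W'] {H : SimpleGraph W}
    {H' : SimpleGraph W'} (φ : H ≃g H') (u : W) : ecc H' (φ u) = ecc H u := by
  obtain ⟨v, hv⟩ := exists_dist_eq_ecc H u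
  refine ecc_eq_of_dist (fun x => ?_) ⟨φ v, ?_⟩
  · obtain ⟨y, rfl⟩ := φ.surjective x
    rw [dist_map_iso]
    exact dist_le_ecc H u y
  · rw [dist_map_iso, hv]

lemma ecc_attachTwoPaths_right (hG : G.Connected) (j : Fin q) :
    ecc (attachTwoPaths G w p q) (.inr (.inr j)) = pathEcc (ecc G w) q p (j + 1) :=
  (ecc_map_iso (attachTwoPathsSwap G w p q) (.inr (.inr j))).symm.trans
    (ecc_attachTwoPaths_left hG j)

open Classical in
lemma deg_eq_sum {W : Type*} [Fintype W] (H : SimpleGraph W) (u : W) :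
    deg H u = ∑ v, if H.Adj u v then 1 else 0 := by
  rw [deg, Finset.card_filter]

lemma deg_map_iso {W W' : Type*} [Fintype W] [Fintype W'] {H : SimpleGraph W}
    {H' : SimpleGraph W'} (φ : H ≃g H') (u : W) : deg H' (φ u) = deg H u := by
  classical
  rw [deg_eq_sum, deg_eq_sum, ← φ.toEquiv.sum_comp]
  simp [φ.map_adj_iff]

lemma Fin.sum_ite_val_eq (n k : ℕ) :
    (∑ i : Fin n, if (i : ℕ) = k then 1 else 0) = if k < n then 1 else 0 := by
  split_ifs with h
  · rw [Finset.sum_eq_single (⟨k, h⟩ : Fin n)] <;> simp [Fin.ext_iff]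
  · exact Finset.sum_eq_zero fun i _ => if_neg (by omega)

open Classical in
lemma deg_attachTwoPaths_inl (a : V) :
    deg (attachTwoPaths G w p q) (.inl a) =
      deg G a + if a = w then (if 0 < p then 1 else 0) + (if 0 < q then 1 else 0) else 0 := by
  by_cases ha : a = w
  · simp only [deg_eq_sum, Fintype.sum_sum_type, ha, attachTwoPaths_adj_inl_inl,
      attachTwoPaths_adj_inl_left, attachTwoPaths_adj_inl_right, true_and, Fin.sum_ite_val_eq,
      if_true]
  · simp only [deg_eq_sum, Fintype.sum_sum_type, ha, attachTwoPaths_adj_inl_inl,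
      attachTwoPaths_adj_inl_left, attachTwoPaths_adj_inl_right, false_and, if_false,
      Finset.sum_const_zero, add_zero]

lemma deg_attachTwoPaths_left (i : Fin p) :
    deg (attachTwoPaths G w p q) (.inr (.inl i)) = 1 + if (i : ℕ) + 1 < p then 1 else 0 := by
  classical
  have hor : ∀ j : Fin p, (if (j : ℕ) = i + 1 ∨ (i : ℕ) = j + 1 then 1 else 0) =
      (if (j : ℕ) = i + 1 then 1 else 0) + (if (i : ℕ) = j + 1 then 1 else 0) := by
    intro j
    split_ifs <;> omega
  simp only [deg_eq_sum, Fintype.sum_sum_type, attachTwoPaths_adj_left_inl,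
    attachTwoPaths_adj_left_left, attachTwoPaths_not_adj_left_right, hor,
    Finset.sum_add_distrib, Fin.sum_ite_val_eq]
  obtain ⟨_ | k, hk⟩ := i
  · simp
  · have : ∀ j : Fin p, (k + 1 = (j : ℕ) + 1) ↔ (j : ℕ) = k := fun j => by omega
    simp only [this, Fin.sum_ite_val_eq]
    simp [show k < p by omega, add_comm]

lemma deg_attachTwoPaths_right (j : Fin q) :
    deg (attachTwoPaths G w p q) (.inr (.inr j)) = 1 + if (j : ℕ) + 1 < q then 1 else 0 :=
  (deg_map_iso (attachTwoPathsSwap G w p q) (.inr (.inr j))).symm.trans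
    (deg_attachTwoPaths_left j)

/-- Summing degree times weight over a pendant path amounts to summing over its edges. -/
lemma sum_path_degree_mul (p : ℕ) (f : ℕ → ℝ) :
    (if 0 < p then 1 else 0) * f 0 +
        ∑ i : Fin p, (1 + if (i : ℕ) + 1 < p then 1 else 0) * f (i + 1) =
      ∑ k ∈ Finset.range p, (f k + f (k + 1)) := by
  rw [Fin.sum_univ_eq_sum_range (fun i => (1 + if i + 1 < p then 1 else 0) * f (i + 1))]
  obtain _ | m := p
  · simp
  · have hlast : ∑ k ∈ Finset.range (m + 1), (if k + 1 < m + 1 then 1 else 0) * f (k + 1) =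
        ∑ k ∈ Finset.range m, f (k + 1) := by
      rw [Finset.sum_range_succ]
      simp only [lt_irrefl, if_false, zero_mul, add_zero]
      exact Finset.sum_congr rfl fun k hk => by simp [Finset.mem_range.mp hk]
    simp only [add_mul, one_mul, Finset.sum_add_distrib, hlast, Nat.succ_pos, if_true]
    rw [Finset.sum_range_succ' f]
    ring

/-- The connective eccentricity index of `attachTwoPaths G w p q` as a sum over the vertices of
`G` plus a sum over the edges of the two pendant paths. -/
lemma cei_attachTwoPaths_eq (hG : G.Connected) :
    cei (attachTwoPaths G w p q) =
      ∑ a, (deg G a : ℝ) / (max (ecc G a) (G.dist a w + max p q) : ℕ) +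
      ∑ k ∈ Finset.range p, ((pathEcc (ecc G w) p q k : ℝ)⁻¹ +
        (pathEcc (ecc G w) p q (k + 1) : ℝ)⁻¹) +
      ∑ k ∈ Finset.range q, ((pathEcc (ecc G w) q p k : ℝ)⁻¹ +
        (pathEcc (ecc G w) q p (k + 1) : ℝ)⁻¹) := by
  classical
  have hp : max (ecc G w) (max p q) = pathEcc (ecc G w) p q 0 := by
    unfold pathEcc; omega
  have hq : max (ecc G w) (max p q) = pathEcc (ecc G w) q p 0 := by
    unfold pathEcc; omega
  rw [← sum_path_degree_mul p fun k => (pathEcc (ecc G w) p q k : ℝ)⁻¹,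
    ← sum_path_degree_mul q fun k => (pathEcc (ecc G w) q p k : ℝ)⁻¹, ← hp, ← hq]
  simp only [cei, Fintype.sum_sum_type, ecc_attachTwoPaths_inl hG, ecc_attachTwoPaths_left hG,
    ecc_attachTwoPaths_right hG, deg_attachTwoPaths_inl, deg_attachTwoPaths_left,
    deg_attachTwoPaths_right, Nat.cast_add, Nat.cast_ite, Nat.cast_one, Nat.cast_zero, div_eq_mul_inv,
    add_mul, one_mul, Finset.sum_add_distrib, ite_mul, zero_mul, Finset.sum_ite_eq',
    Finset.mem_univ, if_true, SimpleGraph.dist_self, zero_add]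
  ring

end attachTwoPaths

lemma inv_pathEcc_le_inv {e p q k e' p' q' k' : ℕ} (he : 1 ≤ e')
    (h : pathEcc e' p' q' k' ≤ pathEcc e p q k) :
    (pathEcc e p q k : ℝ)⁻¹ ≤ (pathEcc e' p' q' k' : ℝ)⁻¹ := by
  have hpos : 0 < pathEcc e' p' q' k' := by unfold pathEcc; omega
  exact inv_anti₀ (by exact_mod_cast hpos) (by exact_mod_cast h)

/-- Moving the last edge of the shorter pendant path to the end of the longer one does not
increase the contribution of the two pendant paths. -/
lemma sum_inv_pathEcc_le {e p r : ℕ} (he : 1 ≤ e) (h : r + 1 ≤ p) :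
    ∑ k ∈ Finset.range (p + 1), ((pathEcc e (p + 1) r k : ℝ)⁻¹ +
        (pathEcc e (p + 1) r (k + 1) : ℝ)⁻¹) +
      ∑ k ∈ Finset.range r, ((pathEcc e r (p + 1) k : ℝ)⁻¹ +
        (pathEcc e r (p + 1) (k + 1) : ℝ)⁻¹) ≤
    ∑ k ∈ Finset.range p, ((pathEcc e p (r + 1) k : ℝ)⁻¹ +
        (pathEcc e p (r + 1) (k + 1) : ℝ)⁻¹) +
      ∑ k ∈ Finset.range (r + 1), ((pathEcc e (r + 1) p k : ℝ)⁻¹ +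
        (pathEcc e (r + 1) p (k + 1) : ℝ)⁻¹) := by
  rcases le_or_gt (r + 1) e with her | her
  · rw [Finset.sum_range_succ, Finset.sum_range_succ (n := r)]
    have hlong : ∀ k, (pathEcc e (p + 1) r k : ℝ)⁻¹ ≤ (pathEcc e p (r + 1) k : ℝ)⁻¹ := fun k =>
      inv_pathEcc_le_inv he (by unfold pathEcc; omega)
    have hshort : ∀ k, (pathEcc e r (p + 1) k : ℝ)⁻¹ ≤ (pathEcc e (r + 1) p k : ℝ)⁻¹ := fun k =>
      inv_pathEcc_le_inv he (by unfold pathEcc; omega)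
    have h₁ : (pathEcc e (p + 1) r p : ℝ)⁻¹ ≤ (pathEcc e (r + 1) p r : ℝ)⁻¹ :=
      inv_pathEcc_le_inv he (by unfold pathEcc; omega)
    have h₂ : (pathEcc e (p + 1) r (p + 1) : ℝ)⁻¹ ≤ (pathEcc e (r + 1) p (r + 1) : ℝ)⁻¹ :=
      inv_pathEcc_le_inv he (by unfold pathEcc; omega)
    have h₃ := Finset.sum_le_sum fun k (_ : k ∈ Finset.range p) =>
      add_le_add (hlong k) (hlong (k + 1))
    have h₄ := Finset.sum_le_sum fun k (_ : k ∈ Finset.range r) =>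
      add_le_add (hshort k) (hshort (k + 1))
    linarith
  · have hlong : ∀ k, pathEcc e (p + 1) r (k + 1) = pathEcc e p (r + 1) k := fun k => by
      unfold pathEcc; omega
    have hshort : ∀ k, pathEcc e r (p + 1) k = pathEcc e (r + 1) p (k + 1) := fun k => by
      unfold pathEcc; omega
    have h₀ : pathEcc e (p + 1) r 0 = pathEcc e (r + 1) p 1 := by
      unfold pathEcc; omega
    have h₁ : pathEcc e p (r + 1) 0 = pathEcc e (r + 1) p 0 := by
      unfold pathEcc; omega
    rw [Finset.sum_range_succ', Finset.sum_range_succ' (n := r)]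
    simp only [hlong, hshort, h₀, h₁, zero_add]
    linarith

lemma one_le_ecc [Fintype V] {G : SimpleGraph V} (hG : G.Connected) (hcard : 2 ≤ Fintype.card V)
    (w : V) : 1 ≤ ecc G w := by
  obtain ⟨v, hv⟩ := Fintype.exists_ne_of_one_lt_card hcard w
  exact (hG.pos_dist_of_ne hv.symm).trans_le (dist_le_ecc G w v)

/-- Transformation B: if `p ≥ q ≥ 1` then
`ξ^{ce}(G(p,q)) ≥ ξ^{ce}(G(p+1,q-1))`. -/
theorem cei_attachTwoPaths [Fintype V]
    (G : SimpleGraph V) (hG : G.Connected) (hcard : 2 ≤ Fintype.card V)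
    (w : V) (p q : ℕ) (hpq : q ≤ p) (hq : 1 ≤ q) :
    cei (attachTwoPaths G w (p + 1) (q - 1)) ≤ cei (attachTwoPaths G w p q) := by
  obtain ⟨r, rfl⟩ := Nat.exists_eq_add_of_le' hq
  rw [Nat.add_sub_cancel, cei_attachTwoPaths_eq hG, cei_attachTwoPaths_eq hG, add_assoc, add_assoc]
  refine add_le_add (Finset.sum_le_sum fun a _ => ?_)
    (sum_inv_pathEcc_le (one_le_ecc hG hcard w) hpq)
  have hpos : 0 < max (ecc G a) (G.dist a w + max p (r + 1)) := by omega
  have hle : max (ecc G a) (G.dist a w + max p (r + 1)) ≤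
      max (ecc G a) (G.dist a w + max (p + 1) r) := by omega
  exact div_le_div_of_nonneg_left (Nat.cast_nonneg _) (by exact_mod_cast hpos)
    (by exact_mod_cast hle)
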